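/- A scattered compact Hausdorff space X is metrizable if and only if the following three conditions hold: (1) X is separable; (2) X has countable scattered height or the space [X]^{<ω} of nonempty finite subsets of X with the Vietoris topology has countable tightness; (3) X is a continuous image of a supercompact space. -/

import Mathlib

open Set Topology TopologicalSpace

universe u

/-- A topological space is *supercompact* if it has a subbase `S` for its topology such that
every cover of the space by members of `S` has a subcover with at most two members. -/
def IsSupercompact (X : Type*) [t : TopologicalSpace X] : Prop :=
  ∃ S : Set (Set X), TopologicalSpace.generateFrom S = t ∧
    ∀ C ⊆ S, ⋃₀ C = univ → ∃ T ⊆ C, T.Finite ∧ T.ncard ≤ 2 ∧ ⋃₀ T = univ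

/-- A topological space is *scattered* if every nonempty subspace has an isolated point. -/
def IsScatteredSpace (X : Type*) [TopologicalSpace X] : Prop :=
  ∀ A : Set X, A.Nonempty → ∃ a ∈ A, ∃ U : Set X, IsOpen U ∧ U ∩ A = {a}

/-- The iterated derived sets of a space: `X⁽ᵅ⁾ = ⋂_{β<α} (X⁽ᵝ⁾)⁽¹⁾`, where `A⁽¹⁾` is the
set of non-isolated points of `A` (points `x ∈ A` lying in the closure of `A \ {x}`).
In particular `X⁽⁰⁾ = X`. -/
noncomputable def iterDerived (X : Type u) [TopologicalSpace X] : Ordinal.{u} → Set X :=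
  WellFounded.fix Ordinal.lt_wf fun α ih =>
    ⋂ (β : Ordinal) (h : β < α), {x | x ∈ ih β h ∧ x ∈ closure (ih β h \ {x})}

/-- The space `[X]^{<ω}` of nonempty finite subsets of `X`. -/
def FiniteSubsets (X : Type u) : Type u := {s : Set X // s.Finite ∧ s.Nonempty}

/-- The Vietoris topology on `[X]^{<ω}`, generated by the sets `{F : F ⊆ U}` and
`{F : F ∩ U ≠ ∅}` for open `U ⊆ X`. -/
noncomputable def vietorisFin (X : Type u) [TopologicalSpace X] :
    TopologicalSpace (FiniteSubsets X) :=
  TopologicalSpace.generateFrom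
    ({t | ∃ U : Set X, IsOpen U ∧ t = {F : FiniteSubsets X | F.1 ⊆ U}} ∪
     {t | ∃ U : Set X, IsOpen U ∧ t = {F : FiniteSubsets X | (F.1 ∩ U).Nonempty}})

/-- `[X]^{<ω}` with the Vietoris topology has countable tightness. -/
def FinVietorisCountableTightness (X : Type u) [TopologicalSpace X] : Prop :=
  ∀ (A : Set (FiniteSubsets X)) (a : FiniteSubsets X),
    a ∈ @closure _ (vietorisFin X) A →
      ∃ B ⊆ A, B.Countable ∧ a ∈ @closure _ (vietorisFin X) B

namespace IsSupercompact

/-- A linked subfamily of the closed subbase has nonempty intersection. -/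
theorem exists_forall_notMem_of_linked {Y : Type*} [Nonempty Y] {S : Set (Set Y)}
    (hS : ∀ C ⊆ S, ⋃₀ C = univ → ∃ T ⊆ C, T.Finite ∧ T.ncard ≤ 2 ∧ ⋃₀ T = univ)
    {C : Set (Set Y)} (hC : C ⊆ S)
    (h : ∀ s ∈ C, ∀ t ∈ C, ∃ y, y ∉ s ∧ y ∉ t) : ∃ q, ∀ s ∈ C, q ∉ s := by
  by_contra! hq
  have hcov : ⋃₀ C = univ := by
    ext q
    simpa using hq q
  obtain ⟨T, hTC, hTf, hcard, hT⟩ := hS C hC hcov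
  have key : ∃ s ∈ T, ∃ t ∈ T, s ∪ t = univ := by
    interval_cases hn : T.ncard
    · rw [Set.ncard_eq_zero hTf] at hn
      subst hn
      simpa using (empty_ne_univ (α := Y) (by simpa using hT)).elim
    · obtain ⟨s, rfl⟩ := Set.ncard_eq_one.1 hn
      exact ⟨s, rfl, s, rfl, by simpa using hT⟩
    · obtain ⟨s, t, -, rfl⟩ := Set.ncard_eq_two.1 hn
      exact ⟨s, by simp, t, by simp, by simpa using hT⟩
  obtain ⟨s, hs, t, ht, hst⟩ := key
  obtain ⟨y, hys, hyt⟩ := h s (hTC hs) t (hTC ht)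
  exact (hst.symm ▸ mem_univ y : y ∈ s ∪ t).elim hys hyt

theorem compactSpace {Y : Type*} [TopologicalSpace Y] (h : IsSupercompact Y) : CompactSpace Y := by
  obtain ⟨S, hgen, hS⟩ := h
  refine ⟨isCompact_generateFrom hgen.symm fun P hP hcov => ?_⟩
  obtain ⟨T, hTP, hTf, -, hT⟩ := hS P hP (univ_subset_iff.1 hcov)
  exact ⟨T, hTP, hTf, hT.ge⟩

end IsSupercompact

/-- In a compact space a clopen set is determined by finitely many members of a subbase. -/
theorem IsClopen.exists_finite_subbase {Y : Type*} [t : TopologicalSpace Y] [CompactSpace Y]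
    {S : Set (Set Y)} (hS : generateFrom S = t) {G : Set Y} (hG : IsClopen G) :
    ∃ F ⊆ S, F.Finite ∧ ∀ y ∈ G, ∀ y', (∀ s ∈ F, y ∉ s → y' ∉ s) → y' ∈ G := by
  have hbas := isTopologicalBasis_of_subbasis hS.symm
  have hloc : ∀ w ∈ Gᶜ, ∃ R : Set (Set Y), (R.Finite ∧ R ⊆ S) ∧ w ∈ ⋂₀ R ∧ ⋂₀ R ⊆ Gᶜ := by
    intro w hw
    obtain ⟨_, ⟨R, hR, rfl⟩, hwR, hRG⟩ := hbas.exists_subset_of_mem_open hw hG.compl.isOpen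
    exact ⟨R, hR, hwR, hRG⟩
  choose! R hR hwR hRG using hloc
  obtain ⟨I, hIG, hcov⟩ := hG.compl.isClosed.isCompact.elim_nhds_subcover (fun w => ⋂₀ R w)
    fun w hw => (hbas.isOpen ⟨R w, hR w hw, rfl⟩).mem_nhds (hwR w hw)
  refine ⟨⋃ w ∈ I, R w, iUnion₂_subset fun w hw => (hR w (hIG w hw)).2,
    I.finite_toSet.biUnion fun w hw => (hR w (hIG w hw)).1, fun y hy y' h => ?_⟩
  by_contra hy'
  obtain ⟨w, hw, hwy'⟩ := mem_iUnion₂.1 (hcov hy')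
  have hyw : y ∉ ⋂₀ R w := fun hyw => hRG w (hIG w hw) hyw hy
  obtain ⟨s, hs, hys⟩ : ∃ s ∈ R w, y ∉ s := by simpa using hyw
  exact h s (mem_iUnion₂.2 ⟨w, hw, hs⟩) hys (hwy' s hs)

section image

variable {X Y : Type*} [TopologicalSpace X] [T2Space X] [tY : TopologicalSpace Y]
  {f : Y → X}

/-- A clopen set in an image of a supercompact space, and a point `x` of it in the closure of `D`:
some intersection of closed subbasic sets lies over the clopen set, has `x` in its image, and
meets a given section over `D`. -/
theorem exists_subbase_inter_of_mem_closure [CompactSpace Y] {S : Set (Set Y)}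
    (hS : generateFrom S = tY) (hf : Continuous f) {g : X → Y} (hg : ∀ x, f (g x) = x)
    {D K : Set X} {x : X} (hK : IsClopen K) (hxK : x ∈ K) (hx : x ∈ closure D) :
    ∃ T ⊆ S, ∃ d ∈ D, ∃ w, (∀ s ∈ T, g d ∉ s) ∧ (f w = x ∧ ∀ s ∈ T, w ∉ s) ∧
      ∀ y, (∀ s ∈ T, y ∉ s) → f y ∈ K := by
  obtain ⟨F, hFS, hF, hdet⟩ := (hK.preimage hf).exists_finite_subbase hS
  let DT : Set (Set Y) → Set X := fun T => {d ∈ D ∩ K | T = {s ∈ F | g d ∉ s}}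
  have hDK : D ∩ K ⊆ ⋃ T ∈ 𝒫 F, DT T := fun d hd =>
    mem_iUnion₂.2 ⟨{s ∈ F | g d ∉ s}, sep_subset _ _, hd, rfl⟩
  have hxDK : x ∈ closure (D ∩ K) := by
    rw [inter_comm]
    exact hK.isOpen.inter_closure ⟨hxK, hx⟩
  have := closure_mono hDK hxDK
  rw [hF.powerset.closure_biUnion] at this
  obtain ⟨T, hTF, hxT⟩ := mem_iUnion₂.1 this
  obtain ⟨d, ⟨hdD, hdK⟩, hd⟩ := closure_nonempty_iff.1 ⟨x, hxT⟩
  have hopen : ∀ s ∈ T, IsOpen s := fun s hs => hS ▸ isOpen_generateFrom_of_mem (hFS (hTF hs))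
  have hclosed : IsClosed {y | ∀ s ∈ T, y ∉ s} := by
    simp only [ofPred_forall]
    exact isClosed_biInter fun s hs => (hopen s hs).isClosed_compl
  have himg : x ∈ f '' {y | ∀ s ∈ T, y ∉ s} := by
    refine closure_minimal ?_ (hclosed.isCompact.image hf).isClosed hxT
    rintro e ⟨-, he⟩
    refine ⟨g e, fun s hs => ?_, hg e⟩
    rw [he] at hs
    exact hs.2
  obtain ⟨w, hw, hwx⟩ := himg
  refine ⟨T, hTF.trans hFS, d, hdD, w, fun s hs => ?_, ⟨hwx, hw⟩, fun y hy => ?_⟩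
  · rw [hd] at hs
    exact hs.2
  · refine hdet (g d) (by simpa [hg] using hdK) y fun s hs hds => hy s ?_
    rw [hd]
    exact ⟨hs, hds⟩

/-- In a Hausdorff image of a supercompact space, an uncountable family of clopen neighbourhoods
`K x` of points in the closure of a countable set has an uncountable subfamily which, outside of
any clopen set `C`, is essentially pierced by finitely many points. -/
theorem IsSupercompact.exists_finite_piercing (hY : IsSupercompact Y) (hf : Continuous f)
    (hsurj : Function.Surjective f) {D E : Set X} (hD : D.Countable) (hE : ¬ E.Countable)
    (hED : E ⊆ closure D) {K : X → Set X} (hK : ∀ x ∈ E, IsClopen (K x) ∧ x ∈ K x) :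
    ∃ E₀ ⊆ E, ¬ E₀.Countable ∧ ∀ C : Set X, IsClopen C → ∃ A : Set X, A.Finite ∧ Disjoint A C ∧
      (∀ a ∈ A, ¬ {x ∈ E₀ | a ∈ K x}.Countable) ∧
      {x ∈ E₀ \ C | Disjoint A (K x)}.Countable := by
  have := hY.compactSpace
  obtain ⟨S, hgen, hS⟩ := hY
  obtain ⟨g, hg⟩ := hsurj.hasRightInverse
  obtain ⟨e, -⟩ : E.Nonempty := by
    by_contra h
    exact hE (by simp [not_nonempty_iff_eq_empty.1 h])
  have : Nonempty X := ⟨e⟩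
  have : Nonempty Y := ⟨g e⟩
  have hloc := fun x (hx : x ∈ E) => exists_subbase_inter_of_mem_closure hgen hf hg
    (hK x hx).1 (hK x hx).2 (hED hx)
  choose! T hTS d hdD w hd hw hTK using hloc
  obtain ⟨p, -, hp⟩ : ∃ p ∈ D, ¬ {x ∈ E | d x = p}.Countable := by
    by_contra! h
    refine hE ((hD.biUnion h).mono fun x hx => ?_)
    exact mem_iUnion₂.2 ⟨d x, hdD x hx, hx, rfl⟩
  refine ⟨{x ∈ E | d x = p}, sep_subset _ _, hp, fun C hC => ?_⟩
  obtain ⟨F, hFS, hF, hdet⟩ := (hC.compl.preimage hf).exists_finite_subbase hgen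
  let EJ : Set (Set Y) → Set X :=
    fun J => {x ∈ {x ∈ E | d x = p} \ C | J = {s ∈ F | w x ∉ s}}
  have hq : ∀ J ∈ {J ∈ 𝒫 F | ¬ (EJ J).Countable}, ∃ a, a ∉ C ∧ ∀ x ∈ EJ J, a ∈ K x := by
    rintro J ⟨hJF, hJ⟩
    have hJw : ∀ x ∈ EJ J, ∀ s ∈ J, w x ∉ s := fun x hx s hs => by
      rw [hx.2] at hs
      exact hs.2
    have hpT : ∀ x ∈ EJ J, ∀ s ∈ T x, g p ∉ s := fun x hx =>
      hx.1.1.2 ▸ hd x hx.1.1.1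
    obtain ⟨x₀, hx₀⟩ : (EJ J).Nonempty := by
      by_contra h
      exact hJ (by simp [not_nonempty_iff_eq_empty.1 h])
    obtain ⟨q, hq⟩ := IsSupercompact.exists_forall_notMem_of_linked hS
      (C := J ∪ ⋃ x ∈ EJ J, T x)
      (union_subset (hJF.trans hFS) (iUnion₂_subset fun x hx => hTS x hx.1.1.1)) (by
        rintro s (hs | hs) t (ht | ht)
        · exact ⟨w x₀, hJw x₀ hx₀ s hs, hJw x₀ hx₀ t ht⟩
        · obtain ⟨x, hx, ht⟩ := mem_iUnion₂.1 ht
          exact ⟨w x, hJw x hx s hs, (hw x hx.1.1.1).2 t ht⟩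
        · obtain ⟨x, hx, hs⟩ := mem_iUnion₂.1 hs
          exact ⟨w x, (hw x hx.1.1.1).2 s hs, hJw x hx t ht⟩
        · obtain ⟨x, hx, hs⟩ := mem_iUnion₂.1 hs
          obtain ⟨x', hx', ht⟩ := mem_iUnion₂.1 ht
          exact ⟨g p, hpT x hx s hs, hpT x' hx' t ht⟩)
    refine ⟨f q, ?_, fun x hx => hTK x hx.1.1.1 q fun s hs =>
      hq s (Or.inr (mem_iUnion₂.2 ⟨x, hx, hs⟩))⟩
    refine hdet (w x₀) (by simpa [(hw x₀ hx₀.1.1.1).1] using hx₀.1.2) q fun s hs hws =>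
      hq s (Or.inl ?_)
    rw [hx₀.2]
    exact ⟨hs, hws⟩
  choose! q hqC hqK using hq
  refine ⟨q '' {J ∈ 𝒫 F | ¬ (EJ J).Countable}, (hF.powerset.subset (sep_subset _ _)).image q,
    ?_, ?_, ?_⟩
  · rw [disjoint_left]
    rintro _ ⟨J, hJ, rfl⟩
    exact hqC J hJ
  · rintro _ ⟨J, hJ, rfl⟩ h
    refine hJ.2 (h.mono fun x (hx : x ∈ EJ J) => ?_)
    exact ⟨hx.1.1, hqK J hJ x hx⟩
  · have hcount : (⋃ J ∈ {J ∈ 𝒫 F | (EJ J).Countable}, EJ J).Countable :=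
      (hF.powerset.subset (sep_subset _ _)).countable.biUnion fun J hJ => hJ.2
    refine hcount.mono fun x hx => ?_
    have hxJ : x ∈ EJ {s ∈ F | w x ∉ s} := ⟨hx.1, rfl⟩
    refine mem_iUnion₂.2 ⟨{s ∈ F | w x ∉ s}, ⟨sep_subset _ _, ?_⟩, hxJ⟩
    by_contra hJ
    have hJ' : {s ∈ F | w x ∉ s} ∈ {J ∈ 𝒫 F | ¬ (EJ J).Countable} := ⟨sep_subset _ _, hJ⟩
    exact disjoint_left.1 hx.2 (mem_image_of_mem q hJ') (hqK _ hJ' x hxJ)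

end image

section scattered

variable {X : Type u} [TopologicalSpace X]

theorem IsScatteredSpace.totallyDisconnectedSpace [T1Space X] (h : IsScatteredSpace X) :
    TotallyDisconnectedSpace X := by
  refine ⟨fun S _ hS => ?_⟩
  by_contra hne
  rw [not_subsingleton_iff] at hne
  obtain ⟨a, haS, U, hU, hUS⟩ := h S hne.nonempty
  have haU : a ∈ U := (hUS.symm ▸ mem_singleton a : a ∈ U ∩ S).1
  obtain ⟨b, hbS, hba⟩ := hne.exists_ne a
  obtain ⟨c, hcS, hcU, hca⟩ := hS U {a}ᶜ hU isOpen_compl_singleton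
    (fun x _ => (eq_or_ne x a).imp (fun hx => by rwa [hx]) id) ⟨a, haS, haU⟩ ⟨b, hbS, hba⟩
  exact hca (hUS ▸ ⟨hcU, hcS⟩ : c ∈ ({a} : Set X))

theorem IsScatteredSpace.countable [SecondCountableTopology X] (h : IsScatteredSpace X) :
    Countable X := by
  obtain ⟨V, D, hV, hD, hVD⟩ :=
    exists_countable_union_perfect_of_isClosed (isClosed_univ (X := X))
  rcases D.eq_empty_or_nonempty with rfl | hne
  · rw [union_empty] at hVD
    exact countable_univ_iff.1 (hVD ▸ hV)
  · obtain ⟨a, haD, U, hU, hUD⟩ := h D hne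
    have haU : a ∈ U := (hUD.symm ▸ mem_singleton a : a ∈ U ∩ D).1
    obtain ⟨y, hy, hya⟩ := accPt_iff_nhds.1 (hD.acc a haD) U (hU.mem_nhds haU)
    exact (hya (hUD ▸ hy : y ∈ ({a} : Set X))).elim

theorem countable_setOf_isOpen_singleton [SeparableSpace X] :
    {x : X | IsOpen {x}}.Countable := by
  obtain ⟨D, hD, hDd⟩ := exists_countable_dense X
  refine hD.mono fun x hx => ?_
  obtain ⟨y, hy, hyD⟩ := hDd.inter_open_nonempty {x} hx (singleton_nonempty x)
  exact (mem_singleton_iff.1 hy) ▸ hyD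

theorem metrizableSpace_of_countable [CompactSpace X] [T2Space X] [TotallyDisconnectedSpace X]
    [Countable X] : MetrizableSpace X := by
  have hsep : ∀ p : {p : X × X // p.1 ≠ p.2}, ∃ V : Set X, IsClopen V ∧ p.1.1 ∈ V ∧ p.1.2 ∉ V := by
    intro p
    obtain ⟨V, hV, h1, h2⟩ := compact_exists_isClopen_in_isOpen
      (isOpen_compl_singleton (x := p.1.2)) p.2
    exact ⟨V, hV, h1, fun h => h2 h rfl⟩
  choose V hV h1 h2 using hsep
  have := Encodable.ofCountable {p : X × X // p.1 ≠ p.2}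
  refine Metric.PiNatEmbed.TopologicalSpace.MetrizableSpace.of_countable_separating
    (fun p x => if (V p).boolIndicator x then (1 : ℝ) else 0) (fun p =>
      (continuous_of_discreteTopology (f := fun b : Bool => if b then (1 : ℝ) else 0)).comp
        ((continuous_boolIndicator_iff_isClopen _).2 (hV p))) fun x y hxy => ?_
  refine ⟨⟨(x, y), hxy⟩, ?_⟩
  rw [(mem_iff_boolIndicator _ _).1 (h1 ⟨(x, y), hxy⟩),
    (notMem_iff_boolIndicator _ _).1 (h2 ⟨(x, y), hxy⟩)]
  simp

theorem mem_iterDerived {α : Ordinal.{u}} {x : X} :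
    x ∈ iterDerived X α ↔
      ∀ β < α, x ∈ iterDerived X β ∧ x ∈ closure (iterDerived X β \ {x}) := by
  rw [iterDerived, WellFounded.fix_eq]
  simp

theorem Ordinal.countable_Iio_of_lt_ord_aleph_one {α : Ordinal.{u}}
    (h : α < (Cardinal.aleph 1).ord) : (Iio α).Countable := by
  rw [Cardinal.lt_ord, ← Cardinal.succ_aleph0, Order.lt_succ_iff] at h
  rw [← Cardinal.le_aleph0_iff_set_countable, Cardinal.mk_Iio_ordinal]
  exact Cardinal.lift_le_aleph0.2 h

theorem IsCompact.countable_of_forall_nhds {C : Set X} (hC : IsCompact C)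
    (h : ∀ x ∈ C, ∃ O ∈ 𝓝 x, O.Countable) : C.Countable :=
  hC.induction_on countable_empty (fun _ _ hst ht => ht.mono hst) (fun _ _ => Countable.union)
    fun x hx => let ⟨O, hO, hOc⟩ := h x hx; ⟨O, mem_nhdsWithin_of_mem_nhds hO, hOc⟩

variable [CompactSpace X] [T2Space X] [TotallyDisconnectedSpace X]

/-- Neighbourhoods of a singleton in the Vietoris topology. -/
theorem exists_isClopen_of_singleton_mem_vietorisFin {𝒪 : Set (FiniteSubsets X)}
    (h𝒪 : IsOpen[vietorisFin X] 𝒪) {z : X}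
    (hz : (⟨{z}, finite_singleton z, singleton_nonempty z⟩ : FiniteSubsets X) ∈ 𝒪) :
    ∃ O : Set X, IsClopen O ∧ z ∈ O ∧ ∀ F : FiniteSubsets X, F.1 ⊆ O → F ∈ 𝒪 := by
  induction h𝒪 with
  | basic t ht =>
    rcases ht with ⟨U, hU, rfl⟩ | ⟨U, hU, rfl⟩
    · obtain ⟨O, hO, hzO, hOU⟩ := compact_exists_isClopen_in_isOpen hU (singleton_subset_iff.1 hz)
      exact ⟨O, hO, hzO, fun F hF => hF.trans hOU⟩
    · obtain ⟨O, hO, hzO, hOU⟩ := compact_exists_isClopen_in_isOpen hU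
        (singleton_inter_nonempty.1 hz)
      exact ⟨O, hO, hzO, fun F hF => F.2.2.mono (subset_inter subset_rfl (hF.trans hOU))⟩
  | univ => exact ⟨univ, isClopen_univ, mem_univ z, fun _ _ => mem_univ _⟩
  | inter s t _ _ ihs iht =>
    obtain ⟨O, hO, hzO, h⟩ := ihs hz.1
    obtain ⟨O', hO', hzO', h'⟩ := iht hz.2
    exact ⟨O ∩ O', hO.inter hO', ⟨hzO, hzO'⟩, fun F hF =>
      ⟨h F (hF.trans inter_subset_left), h' F (hF.trans inter_subset_right)⟩⟩
  | sUnion 𝒮 _ ih =>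
    obtain ⟨s, hs, hzs⟩ := hz
    obtain ⟨O, hO, hzO, h⟩ := ih s hs hzs
    exact ⟨O, hO, hzO, fun F hF => ⟨s, hs, h F hF⟩⟩

variable {Y : Type*} [TopologicalSpace Y] {f : Y → X}

theorem IsSupercompact.countable_of_subset_closure (hY : IsSupercompact Y) (hf : Continuous f)
    (hsurj : Function.Surjective f) {U L : Set X} (hU : U.Countable) (hLU : L ⊆ closure U)
    (hL : ∀ x ∈ L, x ∉ U ∧ ∃ O, IsOpen O ∧ x ∈ O ∧ O ⊆ insert x U) : L.Countable := by
  by_contra hLc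
  have hK : ∀ x ∈ L, ∃ K : Set X, IsClopen K ∧ x ∈ K ∧ K ⊆ insert x U := fun x hx =>
    let ⟨_, O, hO, hxO, hOU⟩ := hL x hx
    let ⟨K, hK, hxK, hKO⟩ := compact_exists_isClopen_in_isOpen hO hxO
    ⟨K, hK, hxK, hKO.trans hOU⟩
  choose! K hKc hxK hKU using hK
  have hself : ∀ x ∈ L, ∀ y ∈ L, x ∈ K y → x = y := fun x hx y hy hxy =>
    (hKU y hy hxy).resolve_right (hL x hx).1
  obtain ⟨E, hEL, hE, hpierce⟩ := hY.exists_finite_piercing hf hsurj hU hLc hLU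
    fun x hx => ⟨hKc x hx, hxK x hx⟩
  let 𝒜 : Set (Set X) := {A | (A.Finite ∧ A ⊆ U) ∧ {x ∈ E | Disjoint A (K x)}.Countable}
  have h𝒜 : 𝒜.Countable := (countable_ofPred_finite_subset hU).mono fun A hA => hA.1
  have hbad : (⋃ A ∈ 𝒜, {x ∈ E | Disjoint A (K x)}).Countable := h𝒜.biUnion fun A hA => hA.2
  obtain ⟨y, hyE, hy⟩ : ∃ y ∈ E, y ∉ ⋃ A ∈ 𝒜, {x ∈ E | Disjoint A (K x)} :=
    not_subset.1 fun h => hE (hbad.mono h)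
  obtain ⟨A, hAf, hAy, hAE, hA⟩ := hpierce (K y) (hKc y (hEL hyE))
  refine hy (mem_iUnion₂.2 ⟨A, ⟨⟨hAf, fun a ha => ?_⟩, ?_⟩, hyE, hAy⟩)
  · by_contra haU
    refine hAE a ha ((countable_singleton a).mono fun x hx => ?_)
    exact ((hKU x (hEL hx.1) hx.2).resolve_right haU).symm
  · refine (hA.union (countable_singleton y)).mono fun x hx => ?_
    rcases eq_or_ne x y with rfl | hxy
    · exact Or.inr rfl
    · exact Or.inl ⟨⟨hx.1, fun h => hxy (hself x (hEL hx.1) y (hEL hyE) h)⟩, hx.2⟩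

theorem IsSupercompact.countable_compl_iterDerived [SeparableSpace X] (hY : IsSupercompact Y)
    (hf : Continuous f) (hsurj : Function.Surjective f) {α : Ordinal.{u}}
    (hα : α < (Cardinal.aleph 1).ord) : (iterDerived X α)ᶜ.Countable := by
  induction α using WellFoundedLT.induction with
  | ind α ih =>
  have hlevel : ∀ β ∈ Iio α, ((iterDerived X β)ᶜ ∪
      {x ∈ iterDerived X β | x ∉ closure (iterDerived X β \ {x})}).Countable := by
    intro β hβ
    have hU := ih β hβ (hβ.trans hα)
    refine hU.union ?_
    have hopen : ∀ x ∈ {x ∈ iterDerived X β | x ∉ closure (iterDerived X β \ {x})},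
        (closure (iterDerived X β \ {x}))ᶜ ⊆ insert x (iterDerived X β)ᶜ := by
      intro x _ y hy
      by_contra h
      rw [mem_insert_iff, not_or] at h
      exact hy (subset_closure ⟨not_not.1 h.2, h.1⟩)
    have hL := hY.countable_of_subset_closure hf hsurj hU
      (L := {x ∈ iterDerived X β | x ∉ closure (iterDerived X β \ {x})} ∩
        closure (iterDerived X β)ᶜ) inter_subset_right fun x hx =>
      ⟨fun h => h hx.1.1, _, isClosed_closure.isOpen_compl, hx.1.2, hopen x hx.1⟩
    refine (hL.union countable_setOf_isOpen_singleton).mono fun x hx => ?_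
    by_cases hxU : x ∈ closure (iterDerived X β)ᶜ
    · exact Or.inl ⟨hx, hxU⟩
    · refine Or.inr ?_
      have : ({x} : Set X) = (closure (iterDerived X β \ {x}))ᶜ ∩
          (closure (iterDerived X β)ᶜ)ᶜ := by
        refine Subset.antisymm (singleton_subset_iff.2 ⟨hx.2, hxU⟩) fun y hy => ?_
        exact (hopen x hx hy.1).resolve_right fun h => hy.2 (subset_closure h)
      rw [mem_ofPred_eq, this]
      exact isClosed_closure.isOpen_compl.inter isClosed_closure.isOpen_compl
  refine ((Ordinal.countable_Iio_of_lt_ord_aleph_one hα).biUnion hlevel).mono fun x hx => ?_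
  rw [mem_compl_iff, mem_iterDerived] at hx
  push Not at hx
  obtain ⟨β, hβ, hx⟩ := hx
  refine mem_iUnion₂.2 ⟨β, hβ, ?_⟩
  by_cases h : x ∈ iterDerived X β
  · exact Or.inr ⟨h, hx h⟩
  · exact Or.inl h

theorem IsSupercompact.countable_of_countableTightness [SeparableSpace X] (hY : IsSupercompact Y)
    (hf : Continuous f) (hsurj : Function.Surjective f) (hscat : IsScatteredSpace X)
    (ht : FinVietorisCountableTightness X) : Countable X := by
  by_contra hX
  let W : Set X := {x | ∃ O ∈ 𝓝 x, O.Countable}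
  have hW : (Wᶜ).Nonempty := by
    by_contra h
    rw [not_nonempty_iff_eq_empty, compl_empty_iff] at h
    refine hX (countable_univ_iff.1 (isCompact_univ.countable_of_forall_nhds fun x _ => ?_))
    exact (h.symm ▸ mem_univ x : x ∈ W)
  obtain ⟨z, hzW, U, hU, hUW⟩ := hscat _ hW
  have hzU : z ∈ U := (hUW.symm ▸ mem_singleton z : z ∈ U ∩ Wᶜ).1
  obtain ⟨V, hV, hzV, hVU⟩ := compact_exists_isClopen_in_isOpen hU hzU
  have hVW : V \ {z} ⊆ W := fun x hx => by
    by_contra hxW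
    exact hx.2 (hUW ▸ ⟨hVU hx.1, hxW⟩ : x ∈ ({z} : Set X))
  have hE : ¬ (V \ {z}).Countable := fun h => hzW ⟨V, hV.isOpen.mem_nhds hzV,
    (h.union (countable_singleton z)).mono fun x hx => by
      by_cases hxz : x = z
      exacts [Or.inr hxz, Or.inl ⟨hx, hxz⟩]⟩
  have hK : ∀ x ∈ V \ {z}, ∃ K : Set X, IsClopen K ∧ x ∈ K ∧ K ⊆ V \ {z} := fun x hx =>
    compact_exists_isClopen_in_isOpen (hV.isOpen.sdiff isClosed_singleton) hx
  choose! K hKc hxK hKV using hK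
  obtain ⟨D, hD, hDd⟩ := exists_countable_dense X
  obtain ⟨E, hEV, hE, hpierce⟩ := hY.exists_finite_piercing hf hsurj hD hE
    (fun x _ => hDd x) fun x hx => ⟨hKc x hx, hxK x hx⟩
  let 𝒜 : Set (FiniteSubsets X) := {A | {x ∈ E | Disjoint A.1 (K x)}.Countable}
  let z' : FiniteSubsets X := ⟨{z}, finite_singleton z, singleton_nonempty z⟩
  have hz𝒜 : z' ∈ @closure _ (vietorisFin X) 𝒜 := by
    rw [@mem_closure_iff _ (vietorisFin X)]
    intro 𝒪 h𝒪 hz𝒪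
    obtain ⟨O, hO, hzO, hO𝒪⟩ := exists_isClopen_of_singleton_mem_vietorisFin h𝒪 hz𝒪
    have hVO : (V \ O).Countable :=
      (hV.diff hO).isClosed.isCompact.countable_of_forall_nhds fun x hx =>
        hVW ⟨hx.1, fun h => hx.2 (mem_singleton_iff.1 h ▸ hzO)⟩
    obtain ⟨A, hAf, hAV, hAE, hA⟩ := hpierce (V \ O) (hV.diff hO)
    have hAc : {x ∈ E | Disjoint A (K x)}.Countable := by
      refine (hA.union hVO).mono fun x hx => ?_
      by_cases hxO : x ∈ V \ O
      exacts [Or.inr hxO, Or.inl ⟨⟨hx.1, hxO⟩, hx.2⟩]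
    have hAne : A.Nonempty := by
      by_contra h
      rw [not_nonempty_iff_eq_empty] at h
      subst h
      exact hE (by simpa using hAc)
    refine ⟨⟨A, hAf, hAne⟩, hO𝒪 _ fun a ha => ?_, hAc⟩
    obtain ⟨x, hxE, hax⟩ : {x ∈ E | a ∈ K x}.Nonempty := by
      by_contra h
      exact hAE a ha (by simp [not_nonempty_iff_eq_empty.1 h])
    by_contra haO
    exact disjoint_left.1 hAV ha ⟨(hKV x (hEV hxE) hax).1, haO⟩
  obtain ⟨ℬ, hℬ𝒜, hℬ, hzℬ⟩ := ht 𝒜 _ hz𝒜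
  obtain ⟨y, hyE, hy⟩ : ∃ y ∈ E, y ∉ ⋃ A ∈ ℬ, {x ∈ E | Disjoint A.1 (K x)} :=
    not_subset.1 fun h => hE ((hℬ.biUnion fun A hA => hℬ𝒜 hA).mono h)
  have hopen : IsOpen[vietorisFin X] {F : FiniteSubsets X | F.1 ⊆ (K y)ᶜ} :=
    isOpen_generateFrom_of_mem (Or.inl ⟨_, (hKc y (hEV hyE)).compl.isOpen, rfl⟩)
  obtain ⟨A, hAy, hAℬ⟩ := (@mem_closure_iff _ (vietorisFin X) _ _).1 hzℬ _ hopen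
    (singleton_subset_iff.2 fun h => (hKV y (hEV hyE) h).2 rfl)
  exact hy (mem_iUnion₂.2 ⟨A, hAℬ, hyE, disjoint_left.2 hAy⟩)

end scattered

theorem isSupercompact_of_isEmpty (X : Type*) [t : TopologicalSpace X] [IsEmpty X] :
    IsSupercompact X :=
  ⟨∅, Subsingleton.elim _ _, fun _ _ _ => ⟨∅, empty_subset _, finite_empty, by simp,
    Subsingleton.elim _ _⟩⟩

theorem isSupercompact_pi_bool (ι : Type*) : IsSupercompact (ι → Bool) := by
  refine ⟨{s | ∃ i b, s = {x : ι → Bool | x i = b}}, le_antisymm ?_ ?_, fun C hC hcov => ?_⟩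
  · refine le_iInf fun i => ?_
    rintro _ ⟨U, -, rfl⟩
    have : (fun x : ι → Bool => x i) ⁻¹' U = ⋃ b ∈ U, {x | x i = b} := by
      ext x
      simp
    rw [this]
    exact @isOpen_biUnion _ _ (_) _ _ fun b _ => isOpen_generateFrom_of_mem ⟨i, b, rfl⟩
  · refine le_generateFrom ?_
    rintro _ ⟨i, b, rfl⟩
    exact (isOpen_discrete ({b} : Set Bool)).preimage (continuous_apply (A := fun _ : ι => Bool) i)
  · obtain ⟨i, h₁, h₂⟩ : ∃ i, {x : ι → Bool | x i = true} ∈ C ∧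
        {x : ι → Bool | x i = false} ∈ C := by
      classical
      by_contra! h
      obtain ⟨s, hs, hxs⟩ : (fun i => decide ({x : ι → Bool | x i = true} ∉ C)) ∈ ⋃₀ C :=
        hcov ▸ mem_univ _
      obtain ⟨i, b, rfl⟩ := hC hs
      cases b
      · have hi : {x : ι → Bool | x i = true} ∈ C := by simpa using hxs
        exact h i hi hs
      · have hi : {x : ι → Bool | x i = true} ∉ C := by simpa using hxs
        exact hi hs
    refine ⟨{{x | x i = true}, {x | x i = false}}, ?_, by simp,
      (ncard_insert_le _ _).trans (by simp), ?_⟩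
    · rintro _ (rfl | rfl)
      exacts [h₁, h₂]
    · ext x
      cases hx : x i <;> simp [hx]

theorem exists_isSupercompact_continuous_surjective (X : Type u) [TopologicalSpace X]
    [CompactSpace X] [MetrizableSpace X] :
    ∃ (Y : Type u) (tY : TopologicalSpace Y) (f : Y → X),
      @T2Space Y tY ∧ @IsSupercompact Y tY ∧ @Continuous Y X tY _ f ∧ Function.Surjective f := by
  rcases isEmpty_or_nonempty X with hX | hX
  · exact ⟨X, inferInstance, id, inferInstance, isSupercompact_of_isEmpty X, continuous_id,
      Function.surjective_id⟩
  · let := metrizableSpaceMetric X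
    obtain ⟨f, hf, hsurj⟩ := exists_nat_bool_continuous_surjective_of_compact X
    refine ⟨ULift.{u} ℕ → Bool, inferInstance, fun y => f fun n => y ⟨n⟩, inferInstance,
      isSupercompact_pi_bool _, hf.comp (continuous_pi fun n => continuous_apply _), fun x => ?_⟩
    obtain ⟨y, rfl⟩ := hsurj x
    exact ⟨fun n => y n.down, rfl⟩

/-- A scattered compact Hausdorff space `X` is metrizable if and only if (1) `X` is
separable, (2) `X` has countable scattered height or `[X]^{<ω}` has countable tightness,
and (3) `X` is a continuous image of a supercompact (Hausdorff) space. -/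
theorem scattered_metrizable_iff
    (X : Type u) [TopologicalSpace X] [CompactSpace X] [T2Space X]
    (hscat : IsScatteredSpace X) :
    TopologicalSpace.MetrizableSpace X ↔
      (TopologicalSpace.SeparableSpace X ∧
       ((∃ α : Ordinal.{u}, α < (Cardinal.aleph 1).ord ∧ iterDerived X α = ∅) ∨
         FinVietorisCountableTightness X) ∧
       (∃ (Y : Type u) (tY : TopologicalSpace Y) (f : Y → X),
         @T2Space Y tY ∧ @IsSupercompact Y tY ∧
         @Continuous Y X tY _ f ∧ Function.Surjective f)) := by
  have := hscat.totallyDisconnectedSpace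
  constructor
  · intro hX
    let := metrizableSpaceMetric X
    have := hscat.countable
    have hc : {s : Set X | s.Finite ∧ s.Nonempty}.Countable := by
      refine (countable_ofPred_finite_subset (countable_univ (α := X))).mono fun s hs => ?_
      exact ⟨hs.1, subset_univ s⟩
    have : Countable (FiniteSubsets X) := hc.to_subtype
    exact ⟨inferInstance, Or.inr fun A a ha => ⟨A, subset_rfl, A.to_countable, ha⟩,
      exists_isSupercompact_continuous_surjective X⟩
  · rintro ⟨hsep, hheight, Y, tY, f, -, hY, hf, hsurj⟩
    suffices Countable X from metrizableSpace_of_countable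
    rcases hheight with ⟨α, hα, hempty⟩ | ht
    · have := hY.countable_compl_iterDerived hf hsurj hα
      rwa [hempty, compl_empty, countable_univ_iff] at this
    · exact hY.countable_of_countableTightness hf hsurj hscat ht
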